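/- Let (X_k)_{k≥1} be i.i.d. with P(X_k = +1) = q and P(X_k = −1) = p = 1 − q, where 0 < q < 1/2 (so q < p), let S_0 = 0, S_i = X_1 + ⋯ + X_i, and let ν = inf{i ≥ 1 : S_i = −1}. Then for every integer n ≥ 0, E[ Σ_{i=1}^{ν} S_i · 1_{(S_i < n) ∧ (S_i < S_{i−1})} ] = (p/(p − q)²) ( 2q − p − (q + n(p − q)) (q/p)^{n+1} ). -/

import Mathlib

open MeasureTheory ProbabilityTheory Filter Finset

/-- Partial sums of the walk: `walkS X n ω = X 1 ω + ⋯ + X n ω` (so `walkS X 0 ω = 0`). -/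
noncomputable def walkS {Ω : Type*} (X : ℕ → Ω → ℤ) (n : ℕ) (ω : Ω) : ℤ :=
  ∑ i ∈ Finset.Icc 1 n, X i ω

/-- First hitting time of `-1` by the walk (`sInf ∅ = 0` by convention). -/
noncomputable def hitMinusOne {Ω : Type*} (X : ℕ → Ω → ℤ) (ω : Ω) : ℕ :=
  sInf {n : ℕ | 1 ≤ n ∧ walkS X n ω = -1}

section aux

variable {Ω : Type*}

lemma walkS_succ' (X : ℕ → Ω → ℤ) (m : ℕ) (ω : Ω) :
    walkS X (m + 1) ω = walkS X m ω + X (m + 1) ω := by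
  unfold walkS
  rw [Finset.sum_Icc_succ_top (by omega)]

lemma walkS_zero' (X : ℕ → Ω → ℤ) (ω : Ω) : walkS X 0 ω = 0 := by
  simp [walkS]

open Classical in
/-- `g (S_m)` on the event that the walk has stayed nonnegative up to time `m`. -/
noncomputable def killed (X : ℕ → Ω → ℤ) (m : ℕ) (g : ℤ → ENNReal) (ω : Ω) : ENNReal :=
  if ∀ j ≤ m, 0 ≤ walkS X j ω then g (walkS X m ω) else 0

open Classical in
lemma killed_factor (X : ℕ → Ω → ℤ) (m : ℕ) (g : ℤ → ENNReal) :
    ∃ φ : ((Finset.Icc 1 m : Finset ℕ) → ℤ) → ENNReal,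
      killed X m g = φ ∘ (fun ω (i : (Finset.Icc 1 m : Finset ℕ)) => X i ω) := by
  refine ⟨fun t => killed (fun i t => if h : i ∈ Finset.Icc 1 m then
    (t : (Finset.Icc 1 m : Finset ℕ) → ℤ) ⟨i, h⟩ else 0) m g t, ?_⟩
  funext ω
  have key : ∀ j ≤ m, walkS (fun i t => if h : i ∈ Finset.Icc 1 m then
    (t : (Finset.Icc 1 m : Finset ℕ) → ℤ) ⟨i, h⟩ else 0) j
      (fun (i : (Finset.Icc 1 m : Finset ℕ)) => X i ω) = walkS X j ω := by
    intro j hj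
    unfold walkS
    refine Finset.sum_congr rfl fun i hi => ?_
    have : i ∈ Finset.Icc 1 m := by
      simp only [Finset.mem_Icc] at hi ⊢; omega
    simp only [this, dif_pos]
  simp only [Function.comp, killed]
  rw [key m le_rfl]
  congr 1
  apply propext
  refine forall_congr' fun j => ?_
  refine forall_congr' fun hj => ?_
  rw [key j hj]

lemma killed_measurable [MeasurableSpace Ω] (X : ℕ → Ω → ℤ) (hmeas : ∀ i, Measurable (X i))
    (m : ℕ) (g : ℤ → ENNReal) : Measurable (killed X m g) := by
  obtain ⟨φ, hφ⟩ := killed_factor X m g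
  rw [hφ]
  exact (measurable_of_countable φ).comp (measurable_pi_lambda _ fun i => hmeas i)

open Classical in
lemma killed_indep [MeasureSpace Ω] [IsProbabilityMeasure (ℙ : Measure Ω)]
    (X : ℕ → Ω → ℤ) (hmeas : ∀ i, Measurable (X i)) (hindep : iIndepFun X ℙ)
    (m : ℕ) (g : ℤ → ENNReal) (e : ℤ) :
    ∫⁻ ω, killed X m g ω * (if X (m + 1) ω = e then 1 else 0) ∂(ℙ : Measure Ω)
      = ℙ {ω | X (m + 1) ω = e} * ∫⁻ ω, killed X m g ω ∂(ℙ : Measure Ω) := by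
  obtain ⟨φ, hφ⟩ := killed_factor X m g
  have h1 := hindep.indepFun_finset (Finset.Icc 1 m) {m + 1} (by simp) hmeas
  have h2 : IndepFun (killed X m g) (fun ω => if X (m + 1) ω = e then (1 : ENNReal) else 0) ℙ := by
    rw [hφ]
    exact h1.comp (measurable_of_countable φ) (measurable_of_countable
      (fun t : (({m + 1} : Finset ℕ) → ℤ) =>
        if t ⟨m + 1, by simp⟩ = e then (1 : ENNReal) else 0))
  have hme : Measurable (fun ω => if X (m + 1) ω = e then (1 : ENNReal) else 0) :=
    (measurable_of_countable (fun z : ℤ => if z = e then (1 : ENNReal) else 0)).comp (hmeas (m + 1))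
  have h3 := lintegral_mul_eq_lintegral_mul_lintegral_of_indepFun
    (killed_measurable X hmeas m g) hme h2
  simp only [Pi.mul_apply] at h3
  rw [h3, mul_comm]
  congr 1
  have : (fun ω => if X (m + 1) ω = e then (1 : ENNReal) else 0)
      = Set.indicator {ω | X (m + 1) ω = e} 1 := by
    funext ω
    simp [Set.indicator]
  rw [this]
  exact lintegral_indicator_one ((hmeas (m + 1)) (measurableSet_singleton e))

open Classical in
lemma killed_step [MeasureSpace Ω] [IsProbabilityMeasure (ℙ : Measure Ω)]
    (X : ℕ → Ω → ℤ) (hmeas : ∀ i, Measurable (X i)) (hindep : iIndepFun X ℙ)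
    (hpm : ∀ᵐ ω ∂(ℙ : Measure Ω), ∀ i, X i ω = 1 ∨ X i ω = -1)
    (P Q : ENNReal)
    (hup : ∀ i, ℙ {ω | X i ω = 1} = Q)
    (hdown : ∀ i, ℙ {ω | X i ω = -1} = P)
    (U d : ℤ → ENNReal) (hU : ∀ y < 0, U y = 0)
    (hUd : ∀ x ≥ 0, U x = d x + (P * U (x - 1) + Q * U (x + 1))) (m : ℕ) :
    ∫⁻ ω, killed X m U ω ∂(ℙ : Measure Ω) = ∫⁻ ω, killed X m d ω ∂(ℙ : Measure Ω)
      + ∫⁻ ω, killed X (m + 1) U ω ∂(ℙ : Measure Ω) := by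
  have e1 : ∫⁻ ω, killed X (m + 1) U ω ∂(ℙ : Measure Ω)
      = ∫⁻ ω, (killed X m (fun x => U (x - 1)) ω * (if X (m + 1) ω = -1 then 1 else 0)
        + killed X m (fun x => U (x + 1)) ω * (if X (m + 1) ω = 1 then 1 else 0))
        ∂(ℙ : Measure Ω) := by
    refine lintegral_congr_ae ?_
    filter_upwards [hpm] with ω hω
    have hs := walkS_succ' X m ω
    by_cases hB : ∀ j ≤ m, 0 ≤ walkS X j ω
    · have hk : killed X (m + 1) U ω = U (walkS X (m + 1) ω) := by
        unfold killed
        split_ifs with h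
        · rfl
        · symm
          apply hU
          by_contra hc
          apply h
          intro j hj
          rcases Nat.lt_or_ge j (m + 1) with h' | h'
          · exact hB j (by omega)
          · have : j = m + 1 := by omega
            subst this; omega
      rw [hk, hs]
      unfold killed
      simp only [if_pos hB]
      rcases hω (m + 1) with h | h <;> rw [h] <;> simp [sub_eq_add_neg]
    · have hB' : ¬ ∀ j ≤ m + 1, 0 ≤ walkS X j ω := fun h => hB fun j hj => h j (by omega)
      unfold killed
      simp only [if_neg hB, if_neg hB']
      simp
  have hind : ∀ e : ℤ, Measurable (fun ω => if X (m + 1) ω = e then (1 : ENNReal) else 0) :=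
    fun e => (measurable_of_countable (fun z : ℤ => if z = e then (1 : ENNReal) else 0)).comp
      (hmeas (m + 1))
  have hm1 : Measurable (fun ω => killed X m (fun x => U (x - 1)) ω *
      (if X (m + 1) ω = -1 then (1 : ENNReal) else 0)) :=
    (killed_measurable X hmeas m _).mul (hind _)
  rw [e1, lintegral_add_left hm1,
    killed_indep X hmeas hindep, killed_indep X hmeas hindep, hup, hdown,
    ← lintegral_const_mul _ (killed_measurable X hmeas m _),
    ← lintegral_const_mul _ (killed_measurable X hmeas m _),
    ← lintegral_add_left ((killed_measurable X hmeas m _).const_mul _),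
    ← lintegral_add_left (killed_measurable X hmeas m _)]
  refine lintegral_congr fun ω => ?_
  unfold killed
  split_ifs with h
  · exact hUd _ (h m le_rfl)
  · simp

lemma killed_sum [MeasureSpace Ω] [IsProbabilityMeasure (ℙ : Measure Ω)]
    (X : ℕ → Ω → ℤ) (hmeas : ∀ i, Measurable (X i)) (hindep : iIndepFun X ℙ)
    (hpm : ∀ᵐ ω ∂(ℙ : Measure Ω), ∀ i, X i ω = 1 ∨ X i ω = -1)
    (P Q : ENNReal)
    (hup : ∀ i, ℙ {ω | X i ω = 1} = Q)
    (hdown : ∀ i, ℙ {ω | X i ω = -1} = P)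
    (U d : ℤ → ENNReal) (hU : ∀ y < 0, U y = 0)
    (hUd : ∀ x ≥ 0, U x = d x + (P * U (x - 1) + Q * U (x + 1))) (M : ℕ) :
    U 0 = ∑ m ∈ Finset.range M, ∫⁻ ω, killed X m d ω ∂(ℙ : Measure Ω)
      + ∫⁻ ω, killed X M U ω ∂(ℙ : Measure Ω) := by
  induction M with
  | zero =>
    have : ∀ ω, killed X 0 U ω = U 0 := by
      intro ω
      unfold killed
      simp [walkS_zero']
    simp [this]
  | succ M ih =>
    rw [ih, killed_step X hmeas hindep hpm P Q hup hdown U d hU hUd M, Finset.sum_range_succ,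
      add_assoc]

/-- Expected number of descents to level `k` from `x` before hitting `-1`. -/
noncomputable def Dk (r : ℝ) (k : ℕ) (x : ℤ) : ℝ :=
  r ^ (k + 2) / (1 - r) * ((r⁻¹) ^ (min x (k + 1) + 1).toNat - 1)

lemma Dk_neg (r : ℝ) (k : ℕ) (x : ℤ) (hx : x < 0) : Dk r k x = 0 := by
  unfold Dk
  have : (min x (k + 1) + 1).toNat = 0 := by omega
  rw [this]; simp

lemma Dk_nonneg (r : ℝ) (h0 : 0 < r) (h1 : r < 1) (k : ℕ) (x : ℤ) : 0 ≤ Dk r k x := by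
  unfold Dk
  have : 1 ≤ (r⁻¹) ^ (min x (k + 1) + 1).toNat := one_le_pow₀ ((one_le_inv₀ h0).2 h1.le)
  have h2 : 0 < 1 - r := by linarith
  have h3 : 0 ≤ (r⁻¹) ^ (min x (k + 1) + 1).toNat - 1 := by linarith
  positivity

lemma Dk_le (r : ℝ) (h0 : 0 < r) (h1 : r < 1) (k : ℕ) (x : ℤ) : Dk r k x ≤ Dk r k (k + 1) := by
  unfold Dk
  have h2 : 0 < 1 - r := by linarith
  have : (r⁻¹) ^ (min x (k + 1) + 1).toNat ≤ (r⁻¹) ^ (min ((k : ℤ) + 1) (k + 1) + 1).toNat :=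
    pow_le_pow_right₀ ((one_le_inv₀ h0).2 h1.le) (by omega)
  have h3 : 0 ≤ r ^ (k + 2) / (1 - r) := by positivity
  exact mul_le_mul_of_nonneg_left (by linarith) h3

lemma Dk_zero (r : ℝ) (h0 : 0 < r) (h1 : r < 1) (k : ℕ) : Dk r k 0 = r ^ (k + 1) := by
  unfold Dk
  have : (min (0 : ℤ) (k + 1) + 1).toNat = 1 := by omega
  rw [this]
  have h2 : 1 - r ≠ 0 := by linarith
  field_simp
  ring

lemma Dk_eq (q p : ℝ) (hq : 0 < q) (hq1 : q < p) (hp : p = 1 - q) (k : ℕ) (x : ℤ) (hx : 0 ≤ x) :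
    Dk (q / p) k x = p * (if x = k + 1 then 1 else 0)
      + (p * Dk (q / p) k (x - 1) + q * Dk (q / p) k (x + 1)) := by
  have hp0 : 0 < p := by linarith
  have hpq : p - q ≠ 0 := by linarith
  obtain ⟨y, rfl⟩ := Int.eq_ofNat_of_zero_le hx
  have hr1 : 1 - q / p = (p - q) / p := by field_simp
  unfold Dk
  rcases lt_trichotomy y (k + 1) with h | h | h
  · have e1 : (min (y : ℤ) (k + 1) + 1).toNat = y + 1 := by omega
    have e2 : (min ((y : ℤ) - 1) (k + 1) + 1).toNat = y := by omega
    have e3 : (min ((y : ℤ) + 1) (k + 1) + 1).toNat = y + 2 := by omega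
    rw [e1, e2, e3, if_neg (by omega)]
    have : (q / p)⁻¹ ^ (y + 1) = p * (q / p)⁻¹ ^ y + q * (q / p)⁻¹ ^ (y + 2) := by
      rw [pow_succ, pow_add, inv_div]
      have : p / q = p + q * (p / q) ^ 2 := by
        field_simp
        rw [hp]; ring
      linear_combination (p / q) ^ y * this
    rw [this, hp]; ring
  · subst h
    have e1 : (min (((k + 1 : ℕ)) : ℤ) (k + 1) + 1).toNat = k + 2 := by omega
    have e2 : (min ((((k + 1 : ℕ)) : ℤ) - 1) (k + 1) + 1).toNat = k + 1 := by omega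
    have e3 : (min ((((k + 1 : ℕ)) : ℤ) + 1) (k + 1) + 1).toNat = k + 2 := by omega
    rw [e1, e2, e3, if_pos (by push_cast; rfl), hr1]
    have a1 : (q / p) ^ (k + 2) * (q / p)⁻¹ ^ (k + 2) = 1 := by
      rw [← mul_pow, mul_inv_cancel₀ (by positivity), one_pow]
    have a2 : (q / p) ^ (k + 2) * (q / p)⁻¹ ^ (k + 1) = q / p := by
      rw [pow_succ (q / p) (k + 1), mul_right_comm, ← mul_pow, mul_inv_cancel₀ (by positivity),
        one_pow, one_mul]
    have b : ∀ z : ℝ, (q / p) ^ (k + 2) / ((p - q) / p) * (z - 1)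
        = ((q / p) ^ (k + 2) * z - (q / p) ^ (k + 2)) / ((p - q) / p) := by
      intro z; ring
    rw [b, b, a1, a2]
    generalize (q / p) ^ (k + 2) = w
    field_simp
    rw [hp]; ring
  · have e1 : (min (y : ℤ) (k + 1) + 1).toNat = k + 2 := by omega
    have e2 : (min ((y : ℤ) - 1) (k + 1) + 1).toNat = k + 2 := by omega
    have e3 : (min ((y : ℤ) + 1) (k + 1) + 1).toNat = k + 2 := by omega
    rw [e1, e2, e3, if_neg (by omega), hp]
    ring

lemma closed_form (q p : ℝ) (hq : 0 < q) (hq1 : q < p) (n : ℕ) :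
    (∑ k ∈ Finset.range n, (k : ℝ) * (q / p) ^ (k + 1)) - 1
      = p / (p - q) ^ 2 * (2 * q - p - (q + n * (p - q)) * (q / p) ^ (n + 1)) := by
  have hp0 : 0 < p := by linarith
  have hpq : p - q ≠ 0 := by linarith
  induction n with
  | zero => simp; field_simp; ring
  | succ n ih =>
    rw [Finset.sum_range_succ, add_sub_right_comm, ih, pow_succ _ (n + 1)]
    generalize (q / p) ^ (n + 1) = w
    push_cast
    field_simp
    ring

/-- Reward for a step down from `x`. -/
noncomputable def rew (n : ℕ) (x : ℤ) : ℝ :=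
  ∑ k ∈ Finset.range n, (k : ℝ) * (if x = k + 1 then 1 else 0)

lemma rew_eq (n : ℕ) (x : ℤ) (hx : 0 ≤ x) :
    rew n (x + 1) = if x < n then (x : ℝ) else 0 := by
  obtain ⟨y, rfl⟩ := Int.eq_ofNat_of_zero_le hx
  unfold rew
  have : ∀ k : ℕ, ((y : ℤ) + 1 = k + 1) ↔ y = k := by intro k; omega
  simp [this]

lemma rew_zero (n : ℕ) : rew n 0 = 0 := by
  unfold rew
  apply Finset.sum_eq_zero
  intro k _
  rw [if_neg (by omega)]; simp

lemma rew_nonneg (n : ℕ) (x : ℤ) : 0 ≤ rew n x := by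
  unfold rew
  apply Finset.sum_nonneg
  intro k _
  split_ifs <;> simp

open Classical in
lemma pathwise (X : ℕ → Ω → ℤ) (n : ℕ) (ω : Ω) (hω : ∀ i, X i ω = 1 ∨ X i ω = -1)
    (hfin : ∃ m, ¬ ∀ j ≤ m, 0 ≤ walkS X j ω) :
    (∑ i ∈ Finset.Icc 1 (hitMinusOne X ω),
        if walkS X i ω < n ∧ walkS X i ω < walkS X (i - 1) ω then (walkS X i ω : ℝ) else 0)
    = (∑' m, killed X m (fun x => ENNReal.ofReal (rew n x)) ω *
        (if X (m + 1) ω = -1 then 1 else 0)).toReal - 1 := by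
  have hex : ∃ m, walkS X m ω < 0 := by
    obtain ⟨m, hm⟩ := hfin
    push Not at hm
    obtain ⟨j, _, hj⟩ := hm
    exact ⟨j, hj⟩
  classical
  obtain ⟨N, hN, hlt⟩ : ∃ N, walkS X N ω < 0 ∧ ∀ j < N, 0 ≤ walkS X j ω :=
    ⟨Nat.find hex, Nat.find_spec hex, fun j hj => not_lt.1 (Nat.find_min hex hj)⟩
  obtain ⟨k, rfl⟩ : ∃ k, N = k + 1 := by
    cases N with
    | zero => rw [walkS_zero'] at hN; omega
    | succ k => exact ⟨k, rfl⟩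
  have hk0 := hlt k (by omega)
  have hks := walkS_succ' X k ω
  have hS : walkS X (k + 1) ω = -1 ∧ walkS X k ω = 0 := by
    rcases hω (k + 1) with h | h <;> omega
  have hhit : hitMinusOne X ω = k + 1 := by
    unfold hitMinusOne
    apply le_antisymm
    · exact Nat.sInf_le ⟨by omega, hS.1⟩
    · refine le_csInf ⟨k + 1, by omega, hS.1⟩ ?_
      rintro b ⟨hb1, hb⟩
      by_contra hc
      have := hlt b (by omega)
      omega
  rw [hhit]
  have ht : (∑' m, killed X m (fun x => ENNReal.ofReal (rew n x)) ω *
        (if X (m + 1) ω = -1 then 1 else 0))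
      = ∑ m ∈ Finset.range (k + 1), killed X m (fun x => ENNReal.ofReal (rew n x)) ω *
        (if X (m + 1) ω = -1 then 1 else 0) := by
    apply tsum_eq_sum
    intro b hb
    have : ¬ ∀ j ≤ b, 0 ≤ walkS X j ω := by
      intro h
      have := h (k + 1) (by simpa using hb)
      omega
    unfold killed
    rw [if_neg this, zero_mul]
  have hkill : ∀ m ≤ k, killed X m (fun x => ENNReal.ofReal (rew n x)) ω
      = ENNReal.ofReal (rew n (walkS X m ω)) := by
    intro m hm
    unfold killed
    rw [if_pos]
    intro j hj
    exact hlt j (by omega)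
  have hI : Finset.Icc 1 (k + 1) = (Finset.range (k + 1)).map (addRightEmbedding 1) := by
    ext i
    simp only [Finset.mem_Icc, Finset.mem_map, Finset.mem_range, addRightEmbedding_apply]
    constructor
    · intro h; exact ⟨i - 1, by omega, by omega⟩
    · rintro ⟨a, h, rfl⟩; omega
  rw [ht, hI, Finset.sum_map, Finset.sum_range_succ, Finset.sum_range_succ, hkill k le_rfl, hS.2,
    rew_zero]
  simp only [ENNReal.ofReal_zero, zero_mul, add_zero, addRightEmbedding_apply,
    Nat.add_sub_cancel, hS.1, hS.2]
  rw [if_pos (by omega), ENNReal.toReal_sum]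
  · rw [sub_eq_add_neg]
    congr 1
    · refine Finset.sum_congr rfl fun m hm => ?_
      have hm' : m < k := by simpa using hm
      rw [hkill m hm'.le]
      have hs := walkS_succ' X m ω
      rcases hω (m + 1) with h | h
      · rw [if_neg (by omega), h]; simp
      · have h0 := hlt (m + 1) (by omega)
        have hw : walkS X m ω = walkS X (m + 1) ω + 1 := by omega
        have hr := rew_eq n _ h0
        rw [if_pos h, mul_one, ENNReal.toReal_ofReal (rew_nonneg _ _), hw, hr]
        have : walkS X (m + 1) ω < walkS X (m + 1) ω + 1 := by omega
        simp only [this, and_true]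
    · simp
  · intro m hm
    have hm' : m < k := by simpa using hm
    rw [hkill m hm'.le]
    split_ifs <;> simp

end aux

theorem stmt10 {Ω : Type*} [MeasureSpace Ω] [IsProbabilityMeasure (ℙ : Measure Ω)]
    (q p : ℝ) (hq : 0 < q) (hq1 : q < 1 / 2) (hp : p = 1 - q)
    (X : ℕ → Ω → ℤ) (hmeas : ∀ i, Measurable (X i))
    (hindep : iIndepFun X ℙ)
    (hup : ∀ i, ℙ {ω | X i ω = 1} = ENNReal.ofReal q)
    (hdown : ∀ i, ℙ {ω | X i ω = -1} = ENNReal.ofReal p)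
    (n : ℕ) :
    ∫ ω, (∑ i ∈ Finset.Icc 1 (hitMinusOne X ω),
        if walkS X i ω < n ∧ walkS X i ω < walkS X (i - 1) ω then (walkS X i ω : ℝ) else 0)
        ∂(ℙ : Measure Ω)
      = p / (p - q) ^ 2 * (2 * q - p - (q + n * (p - q)) * (q / p) ^ (n + 1)) := by
  classical
  have hp0 : 0 < p := by linarith
  have hqp : q < p := by linarith
  have hr0 : 0 < q / p := by positivity
  have hr1 : q / p < 1 := by rw [div_lt_one hp0]; exact hqp
  -- steps are ±1 almost surely
  have hpm : ∀ᵐ ω ∂(ℙ : Measure Ω), ∀ i, X i ω = 1 ∨ X i ω = -1 := by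
    rw [ae_all_iff]
    intro i
    have hms : ∀ e : ℤ, MeasurableSet {ω | X i ω = e} :=
      fun e => hmeas i (measurableSet_singleton e)
    have hd : Disjoint {ω | X i ω = 1} {ω | X i ω = -1} := by
      rw [Set.disjoint_left]
      intro ω h1 h2
      simp only [Set.mem_ofPred_eq] at h1 h2
      omega
    have hu : ℙ ({ω | X i ω = 1} ∪ {ω | X i ω = -1}) = 1 := by
      rw [measure_union hd (hms _), hup, hdown, ← ENNReal.ofReal_add hq.le hp0.le, hp]
      simp
    have := (prob_compl_eq_zero_iff ((hms 1).union (hms (-1)))).2 hu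
    exact this
  set P := ENNReal.ofReal p with hP
  set Q := ENNReal.ofReal q with hQ
  -- survival
  have hsurv : ∑' m, ∫⁻ ω, killed X m (fun _ => 1) ω ∂(ℙ : Measure Ω) ≠ ⊤ := by
    have hh := killed_sum X hmeas hindep hpm P Q hup hdown
      (fun x => ENNReal.ofReal (((x + 1).toNat : ℕ) : ℝ)) (fun _ => ENNReal.ofReal (p - q))
      (by
        intro y hy
        have : (y + 1).toNat = 0 := by omega
        simp [this])
      (by
        intro x hx
        obtain ⟨y, rfl⟩ := Int.eq_ofNat_of_zero_le hx
        have e1 : ((y : ℤ) + 1).toNat = y + 1 := by omega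
        have e2 : ((y : ℤ) - 1 + 1).toNat = y := by omega
        have e3 : ((y : ℤ) + 1 + 1).toNat = y + 2 := by omega
        simp only [e1, e2, e3]
        rw [hP, hQ, ← ENNReal.ofReal_mul hp0.le, ← ENNReal.ofReal_mul hq.le,
          ← ENNReal.ofReal_add (by positivity) (by positivity),
          ← ENNReal.ofReal_add (by linarith) (by positivity)]
        congr 1
        push_cast
        rw [hp]; ring)
    have hc : ∀ m, ∫⁻ ω, killed X m (fun _ => ENNReal.ofReal (p - q)) ω ∂(ℙ : Measure Ω)
        = ENNReal.ofReal (p - q) * ∫⁻ ω, killed X m (fun _ => 1) ω ∂(ℙ : Measure Ω) := by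
      intro m
      rw [← lintegral_const_mul _ (killed_measurable X hmeas m _)]
      refine lintegral_congr fun ω => ?_
      unfold killed
      split_ifs <;> simp
    have hle : ENNReal.ofReal (p - q) * ∑' m, ∫⁻ ω, killed X m (fun _ => 1) ω ∂(ℙ : Measure Ω)
        ≤ 1 := by
      rw [← ENNReal.tsum_mul_left]
      apply ENNReal.tsum_le_of_sum_range_le
      intro M
      have := hh M
      simp only [hc] at this
      calc _ ≤ _ := le_self_add
        _ = _ := this.symm
        _ ≤ 1 := by simp
    intro htop
    rw [htop, ENNReal.mul_top] at hle
    · simp at hle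
    · simp only [ne_eq, ENNReal.ofReal_eq_zero, not_le]; linarith
  have hsurv0 := ENNReal.tendsto_atTop_zero_of_tsum_ne_top hsurv
  have hfin : ∀ᵐ ω ∂(ℙ : Measure Ω), ∃ m, ¬ ∀ j ≤ m, 0 ≤ walkS X j ω := by
    have h1 : ∫⁻ ω, ∑' m, killed X m (fun _ => 1) ω ∂(ℙ : Measure Ω) ≠ ⊤ := by
      rw [lintegral_tsum fun m => (killed_measurable X hmeas m _).aemeasurable]
      exact hsurv
    have h2 := ae_lt_top (Measurable.tsum fun m =>
      killed_measurable X hmeas m (fun _ => 1)) h1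
    filter_upwards [h2] with ω hω
    by_contra hc
    push Not at hc
    have : ∀ m, killed X m (fun _ => 1) ω = 1 := by
      intro m
      unfold killed
      rw [if_pos (hc m)]
    simp [this] at hω
  -- the potential
  set u : ℤ → ℝ := fun x => ∑ k ∈ Finset.range n, (k : ℝ) * Dk (q / p) k x with hu
  have hu0 : ∀ x, 0 ≤ u x := fun x => Finset.sum_nonneg fun k _ =>
    mul_nonneg (by positivity) (Dk_nonneg _ hr0 hr1 _ _)
  have hsum := killed_sum X hmeas hindep hpm P Q hup hdown
    (fun x => ENNReal.ofReal (u x)) (fun x => P * ENNReal.ofReal (rew n x))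
    (by
      intro y hy
      have : u y = 0 := Finset.sum_eq_zero fun k _ => by rw [Dk_neg _ _ _ hy, mul_zero]
      simp [this])
    (by
      intro x hx
      have hpu : 0 ≤ p * u (x - 1) := mul_nonneg hp0.le (hu0 _)
      have hqu : 0 ≤ q * u (x + 1) := mul_nonneg hq.le (hu0 _)
      have hpr : 0 ≤ p * rew n x := mul_nonneg hp0.le (rew_nonneg _ _)
      rw [hP, hQ, ← ENNReal.ofReal_mul hp0.le, ← ENNReal.ofReal_mul hq.le,
        ← ENNReal.ofReal_mul hp0.le,
        ← ENNReal.ofReal_add hpu hqu, ← ENNReal.ofReal_add hpr (by positivity)]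
      congr 1
      simp only [hu, rew, Finset.mul_sum]
      rw [← Finset.sum_add_distrib, ← Finset.sum_add_distrib]
      refine Finset.sum_congr rfl fun k _ => ?_
      rw [Dk_eq q p hq hqp hp k x hx]
      ring)
  obtain ⟨C, hC⟩ : ∃ C : ℝ, ∀ x, u x ≤ C :=
    ⟨∑ k ∈ Finset.range n, (k : ℝ) * Dk (q / p) k (k + 1), fun x => Finset.sum_le_sum fun k _ =>
      mul_le_mul_of_nonneg_left (Dk_le _ hr0 hr1 _ _) (by positivity)⟩
  have hlim : Tendsto (fun M => ∫⁻ ω, killed X M (fun x => ENNReal.ofReal (u x)) ω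
      ∂(ℙ : Measure Ω)) atTop (nhds 0) := by
    have h1 : Tendsto (fun M => ENNReal.ofReal C * ∫⁻ ω, killed X M (fun _ => 1) ω
        ∂(ℙ : Measure Ω)) atTop (nhds 0) := by
      have := ENNReal.Tendsto.const_mul (a := ENNReal.ofReal C) hsurv0 (Or.inr ENNReal.ofReal_ne_top)
      simpa using this
    refine tendsto_of_tendsto_of_tendsto_of_le_of_le tendsto_const_nhds h1
      (fun _ => zero_le) (fun M => ?_)
    rw [← lintegral_const_mul _ (killed_measurable X hmeas M _)]
    refine lintegral_mono fun ω => ?_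
    unfold killed
    split_ifs
    · rw [mul_one]; exact ENNReal.ofReal_le_ofReal (hC _)
    · simp
  have htot : ∑' m, ∫⁻ ω, killed X m (fun x => P * ENNReal.ofReal (rew n x)) ω ∂(ℙ : Measure Ω)
      = ENNReal.ofReal (u 0) := by
    have h1 := (ENNReal.tendsto_nat_tsum (fun m =>
      ∫⁻ ω, killed X m (fun x => P * ENNReal.ofReal (rew n x)) ω ∂(ℙ : Measure Ω))).add hlim
    rw [add_zero] at h1
    refine tendsto_nhds_unique h1 ?_
    simp only [← hsum]
    exact tendsto_const_nhds
  have hmG : ∀ m, Measurable (fun ω => killed X m (fun x => ENNReal.ofReal (rew n x)) ω *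
        (if X (m + 1) ω = -1 then (1 : ENNReal) else 0)) := fun m =>
    (killed_measurable X hmeas m _).mul
      ((measurable_of_countable (fun z : ℤ => if z = -1 then (1 : ENNReal) else 0)).comp
      (hmeas (m + 1)))
  have hG : ∫⁻ ω, (∑' m, killed X m (fun x => ENNReal.ofReal (rew n x)) ω *
        (if X (m + 1) ω = -1 then 1 else 0)) ∂(ℙ : Measure Ω) = ENNReal.ofReal (u 0) := by
    rw [lintegral_tsum fun m => (hmG m).aemeasurable, ← htot]
    refine tsum_congr fun m => ?_
    rw [killed_indep X hmeas hindep, hdown,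
      ← lintegral_const_mul _ (killed_measurable X hmeas m _)]
    refine lintegral_congr fun ω => ?_
    unfold killed
    split_ifs <;> simp
  have hmT : Measurable (fun ω => ∑' m, killed X m (fun x => ENNReal.ofReal (rew n x)) ω *
        (if X (m + 1) ω = -1 then (1 : ENNReal) else 0)) := Measurable.tsum hmG
  have hne : ∫⁻ ω, (∑' m, killed X m (fun x => ENNReal.ofReal (rew n x)) ω *
        (if X (m + 1) ω = -1 then 1 else 0)) ∂(ℙ : Measure Ω) ≠ ⊤ := by
    rw [hG]; exact ENNReal.ofReal_ne_top
  have hae : (fun ω => ∑ i ∈ Finset.Icc 1 (hitMinusOne X ω),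
        if walkS X i ω < n ∧ walkS X i ω < walkS X (i - 1) ω then (walkS X i ω : ℝ) else 0)
      =ᵐ[(ℙ : Measure Ω)] fun ω => (∑' m, killed X m (fun x => ENNReal.ofReal (rew n x)) ω *
        (if X (m + 1) ω = -1 then (1 : ENNReal) else 0)).toReal - 1 := by
    filter_upwards [hpm, hfin] with ω h1 h2 using pathwise X n ω h1 h2
  rw [integral_congr_ae hae, integral_sub (integrable_toReal_of_lintegral_ne_top
    hmT.aemeasurable hne) (integrable_const _),
    integral_toReal hmT.aemeasurable (ae_lt_top hmT hne), hG,
    ENNReal.toReal_ofReal (hu0 0), ← closed_form q p hq hqp n]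
  simp only [hu, Dk_zero _ hr0 hr1]
  simp
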